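/- Consider the linear time-varying system ẋ(t) = A(t)x(t) + G(t)w(t) with x(t₀) = 0 and output y(t) = C(t)x(t) on Ω = [t₀, t₀+T], where now A(·), G(·), C(·) are only piecewise continuous (with finitely many discontinuity points) matrix-valued functions on Ω. Suppose there exist a scalar ξ > 1 and a piecewise continuously differentiable positive definite matrix-valued function P : Ω → ℝ^{n×n} such that, at every t ∈ Ω at which all the data are continuous, the block matrix [[Ṗ(t) + A(t)ᵀP(t) + P(t)A(t), P(t)G(t)], [G(t)ᵀP(t), −R(t)]] is negative definite, and for every t ∈ Ω, P(t) − ξC(t)ᵀQ(t)C(t) is positive definite. Then the system is IO-FTS with respect to (W₂, Q(·), Ω): for every w ∈ W₂ and every locally absolutely continuous solution x with x(t₀) = 0, the output satisfies y(t)ᵀQ(t)y(t) < 1 for all t ∈ Ω. -/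

import Mathlib

open MeasureTheory Matrix Set

lemma ioaux_pointwise {n r : ℕ} (A P P' : Matrix (Fin n) (Fin n) ℝ) (G : Matrix (Fin n) (Fin r) ℝ)
    (R : Matrix (Fin r) (Fin r) ℝ)
    (h : (-(Matrix.fromBlocks (P' + Aᵀ * P + P * A) (P * G) (Gᵀ * P) (-R))).PosDef)
    (x : Fin n → ℝ) (w : Fin r → ℝ) :
    (A *ᵥ x + G *ᵥ w) ⬝ᵥ (P *ᵥ x) + x ⬝ᵥ (P' *ᵥ x + P *ᵥ (A *ᵥ x + G *ᵥ w))
      ≤ w ⬝ᵥ (R *ᵥ w) := by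
  have h1 := h.posSemidef.dotProduct_mulVec_nonneg (Sum.elim x w)
  have e1 : ∀ v : Fin n → ℝ, x ⬝ᵥ (Aᵀ *ᵥ v) = (A *ᵥ x) ⬝ᵥ v := by
    intro v
    rw [Matrix.dotProduct_mulVec, Matrix.vecMul_transpose]
  have e2 : ∀ v : Fin n → ℝ, w ⬝ᵥ (Gᵀ *ᵥ v) = (G *ᵥ w) ⬝ᵥ v := by
    intro v
    rw [Matrix.dotProduct_mulVec, Matrix.vecMul_transpose]
  simp only [star_trivial, Matrix.neg_mulVec, Matrix.fromBlocks_mulVec, Sum.elim_comp_inl,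
    Sum.elim_comp_inr, dotProduct_neg, sumElim_dotProduct_sumElim, Matrix.add_mulVec,
    dotProduct_add, ← Matrix.mulVec_mulVec, e1, e2] at h1
  simp only [add_dotProduct, dotProduct_add, Matrix.mulVec_add]
  linarith

lemma ioaux_glue (c d : ℝ) (D : Finset ℝ) (F : ℝ → ℝ) (hF : ContinuousOn F (Icc c d))
    (h : ∀ a b, a < b → Icc a b ⊆ Icc c d \ (D : Set ℝ) → F b ≤ F a) :
    ∀ a ∈ Icc c d, ∀ b ∈ Icc c d, a ≤ b → F b ≤ F a := by
  have key : ∀ a ∈ Icc c d, ∀ b ∈ Icc c d, a < b → (∀ t ∈ D, t ∉ Ioo a b) → F b ≤ F a := by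
    intro a ha b hb hab hD
    have hs : Icc a b ⊆ Icc c d := Icc_subset_Icc ha.1 hb.2
    have h1 : ∀ p ∈ Ioo a b, ∀ q ∈ Ioo a b, p ≤ q → F q ≤ F p := by
      intro p hp q hq hpq
      rcases hpq.eq_or_lt with rfl | hlt
      · exact le_rfl
      · refine h p q hlt fun t ht => ⟨hs ⟨hp.1.le.trans ht.1, ht.2.trans hq.2.le⟩, fun htD => ?_⟩
        exact hD t htD ⟨hp.1.trans_le ht.1, ht.2.trans_lt hq.2⟩
    obtain ⟨p, hp⟩ := exists_between hab
    have hb1 : F b ≤ F p := by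
      refine ContinuousWithinAt.closure_le (s := Ioo p b) (f := F) (g := fun _ => F p) (x := b)
        ?_ ((hF b hb).mono fun q hq => hs ⟨hp.1.le.trans hq.1.le, hq.2.le⟩)
        continuousWithinAt_const fun q hq => h1 p hp q ⟨hp.1.trans hq.1, hq.2⟩ hq.1.le
      rw [closure_Ioo hp.2.ne]
      exact right_mem_Icc.2 hp.2.le
    have ha1 : F p ≤ F a := by
      refine ContinuousWithinAt.closure_le (s := Ioo a p) (f := fun _ => F p) (g := F) (x := a)
        ?_ continuousWithinAt_const
        ((hF a ha).mono fun q hq => hs ⟨hq.1.le, hq.2.le.trans hp.2.le⟩)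
        fun q hq => h1 q ⟨hq.1, hq.2.trans hp.2⟩ p hp hq.2.le
      rw [closure_Ioo hp.1.ne]
      exact left_mem_Icc.2 hp.1.le
    exact hb1.trans ha1
  have ind : ∀ N : ℕ, ∀ a ∈ Icc c d, ∀ b ∈ Icc c d, a ≤ b →
      (D.filter (fun t => t ∈ Ioo a b)).card ≤ N → F b ≤ F a := by
    intro N
    induction N with
    | zero =>
      intro a ha b hb hab hN
      rcases hab.eq_or_lt with rfl | hlt
      · exact le_rfl
      refine key a ha b hb hlt fun t ht htI => ?_
      have : D.filter (fun t => t ∈ Ioo a b) = ∅ := by simpa using hN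
      exact absurd (Finset.mem_filter.2 ⟨ht, htI⟩) (by rw [this]; simp)
    | succ N ih =>
      intro a ha b hb hab hN
      by_cases hex : ∃ t ∈ D, t ∈ Ioo a b
      · obtain ⟨t, htD, ht⟩ := hex
        have htI : t ∈ Icc c d := ⟨ha.1.trans ht.1.le, ht.2.le.trans hb.2⟩
        have hmem : t ∈ D.filter (fun t => t ∈ Ioo a b) := Finset.mem_filter.2 ⟨htD, ht⟩
        have l1 : (D.filter (fun s => s ∈ Ioo a t)).card < (D.filter (fun s => s ∈ Ioo a b)).card := by
          apply Finset.card_lt_card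
          rw [Finset.ssubset_iff_of_subset]
          · exact ⟨t, hmem, by simp⟩
          · intro s hs
            rw [Finset.mem_filter] at hs ⊢
            exact ⟨hs.1, hs.2.1, hs.2.2.trans ht.2⟩
        have l2 : (D.filter (fun s => s ∈ Ioo t b)).card < (D.filter (fun s => s ∈ Ioo a b)).card := by
          apply Finset.card_lt_card
          rw [Finset.ssubset_iff_of_subset]
          · exact ⟨t, hmem, by simp⟩
          · intro s hs
            rw [Finset.mem_filter] at hs ⊢
            exact ⟨hs.1, ht.1.trans hs.2.1, hs.2.2⟩
        exact (ih t htI b hb ht.2.le (by omega)).trans (ih a ha t htI ht.1.le (by omega))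
      · push Not at hex
        rcases hab.eq_or_lt with rfl | hlt
        · exact le_rfl
        exact key a ha b hb hlt hex
  intro a ha b hb hab
  exact ind _ a ha b hb hab le_rfl

lemma ioaux_ac_sum {ι : Type*} (s : Finset ι) (f : ι → ℝ → ℝ) (a b : ℝ)
    (h : ∀ i ∈ s, AbsolutelyContinuousOnInterval (f i) a b) :
    AbsolutelyContinuousOnInterval (fun t => ∑ i ∈ s, f i t) a b := by
  classical
  induction s using Finset.induction_on with
  | empty =>
    simp only [Finset.sum_empty]
    exact (LipschitzWith.const (0 : ℝ)).lipschitzOnWith.absolutelyContinuousOnInterval (K := 0)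
  | insert i s hi ih =>
    simp only [Finset.sum_insert hi]
    exact (h i (Finset.mem_insert_self _ _)).fun_add
      (ih fun j hj => h j (Finset.mem_insert_of_mem hj))

lemma ioaux_ac_C1 (f f' : ℝ → ℝ) (a b : ℝ) (hab : a ≤ b) (hc : ContinuousOn f' (Icc a b))
    (hd : ∀ t ∈ Icc a b, HasDerivWithinAt f (f' t) (Icc a b) t) :
    AbsolutelyContinuousOnInterval f a b := by
  obtain ⟨K, hK⟩ := isCompact_Icc.exists_bound_of_continuousOn hc
  have := (convex_Icc a b).lipschitzOnWith_of_nnnorm_hasDerivWithin_le (C := K.toNNReal) hd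
    (fun t ht => by
      rw [← NNReal.coe_le_coe, coe_nnnorm]
      exact (hK t ht).trans (Real.le_coe_toNNReal K))
  rw [← uIcc_of_le hab] at this
  exact this.absolutelyContinuousOnInterval

/-- **IO-FTS w.r.t. W₂ inputs for systems with piecewise continuous data.**
Suppose `A(·), G(·), C(·)` are continuous on `Ω = [t₀, t₀+T]` except at finitely many
points `D`. If there exist `ξ > 1` and a piecewise continuously differentiable positive
definite `P(·)` such that at every point of continuity of the data the block matrix
`[[Ṗ + AᵀP + PA, PG], [GᵀP, −R]]` is negative definite, and `P − ξCᵀQC > 0` on all of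
`Ω`, then the system `ẋ = A x + G w`, `x(t₀) = 0`, `y = C x` is IO-FTS w.r.t.
`(W₂, Q(·), Ω)`. -/
theorem io_fts_piecewise_continuous_data
    {n r m : ℕ} (t₀ T : ℝ) (hT : 0 < T)
    (A : ℝ → Matrix (Fin n) (Fin n) ℝ)
    (G : ℝ → Matrix (Fin n) (Fin r) ℝ)
    (C : ℝ → Matrix (Fin m) (Fin n) ℝ)
    (R : ℝ → Matrix (Fin r) (Fin r) ℝ)
    (Q : ℝ → Matrix (Fin m) (Fin m) ℝ)
    -- `D` is the finite set of possible discontinuity points of the data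
    (D : Finset ℝ)
    (hA : ∀ i j, ContinuousOn (fun t => A t i j) (Icc t₀ (t₀ + T) \ D))
    (hG : ∀ i j, ContinuousOn (fun t => G t i j) (Icc t₀ (t₀ + T) \ D))
    (hC : ∀ i j, ContinuousOn (fun t => C t i j) (Icc t₀ (t₀ + T) \ D))
    (hR : ∀ i j, ContinuousOn (fun t => R t i j) (Icc t₀ (t₀ + T)))
    (hQ : ∀ i j, ContinuousOn (fun t => Q t i j) (Icc t₀ (t₀ + T)))
    (hRpd : ∀ t ∈ Icc t₀ (t₀ + T), (R t).PosDef)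
    (hQpd : ∀ t ∈ Icc t₀ (t₀ + T), (Q t).PosDef)
    (ξ : ℝ) (hξ : 1 < ξ)
    -- `P` positive definite, continuous, piecewise C¹ (differentiable off `D`)
    (P P' : ℝ → Matrix (Fin n) (Fin n) ℝ)
    (hPpd : ∀ t ∈ Icc t₀ (t₀ + T), (P t).PosDef)
    (hPcont : ∀ i j, ContinuousOn (fun t => P t i j) (Icc t₀ (t₀ + T)))
    (hP'cont : ∀ i j, ContinuousOn (fun t => P' t i j) (Icc t₀ (t₀ + T) \ D))
    (hPderiv : ∀ t ∈ Icc t₀ (t₀ + T) \ (D : Set ℝ), ∀ i j,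
      HasDerivWithinAt (fun s => P s i j) (P' t i j) (Icc t₀ (t₀ + T) \ D) t)
    -- the DLMI at points where all the data are continuous
    (hDLMI : ∀ t ∈ Icc t₀ (t₀ + T) \ (D : Set ℝ),
      (-(Matrix.fromBlocks (P' t + (A t)ᵀ * P t + P t * A t) (P t * G t)
          ((G t)ᵀ * P t) (-(R t)))).PosDef)
    -- the LMI with margin: `P > ξ CᵀQC` on `Ω`
    (hLMI : ∀ t ∈ Icc t₀ (t₀ + T), (P t - ξ • ((C t)ᵀ * Q t * C t)).PosDef) :
    -- IO-FTS with respect to `(W₂, Q(·), Ω)`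
    ∀ w : ℝ → Fin r → ℝ, Measurable w →
      IntervalIntegrable (fun τ => w τ ⬝ᵥ (R τ *ᵥ w τ)) volume t₀ (t₀ + T) →
      (∫ τ in t₀..(t₀ + T), w τ ⬝ᵥ (R τ *ᵥ w τ)) ≤ 1 →
      ∀ x : ℝ → Fin n → ℝ,
        (∀ t ∈ Icc t₀ (t₀ + T),
          IntervalIntegrable (fun τ => A τ *ᵥ x τ + G τ *ᵥ w τ) volume t₀ t ∧
          x t = ∫ τ in t₀..t, (A τ *ᵥ x τ + G τ *ᵥ w τ)) →
        ∀ t ∈ Icc t₀ (t₀ + T), (C t *ᵥ x t) ⬝ᵥ (Q t *ᵥ (C t *ᵥ x t)) < 1 := by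
  intro w _ hwint hw1 x hx t ht
  have hle : t₀ ≤ t₀ + T := by linarith
  set f : ℝ → Fin n → ℝ := fun τ => A τ *ᵥ x τ + G τ *ᵥ w τ with hf
  set g : ℝ → ℝ := fun τ => w τ ⬝ᵥ (R τ *ᵥ w τ) with hg
  have hfint : IntervalIntegrable f volume t₀ (t₀ + T) := (hx _ (right_mem_Icc.2 hle)).1
  have hfi : ∀ i, IntervalIntegrable (fun τ => f τ i) volume t₀ (t₀ + T) := fun i =>
    ⟨hfint.1.eval i, hfint.2.eval i⟩
  let X : ℝ → Fin n → ℝ := fun t i => ∫ τ in t₀..t, f τ i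
  have hxX : ∀ t ∈ Icc t₀ (t₀ + T), x t = X t := by
    intro t ht
    rw [(hx t ht).2]
    funext i
    exact (ContinuousLinearMap.proj (R := ℝ) (φ := fun _ : Fin n => ℝ) i).intervalIntegral_comp_comm
      (hx t ht).1 |>.symm
  have hXac : ∀ i, AbsolutelyContinuousOnInterval (fun t => X t i) t₀ (t₀ + T) := fun i =>
    (hfi i).absolutelyContinuousOnInterval_intervalIntegral left_mem_uIcc
  have hXder : ∀ᵐ t, t ∈ Icc t₀ (t₀ + T) → ∀ i, HasDerivAt (fun t => X t i) (f t i) t := by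
    have := fun i => (hfi i).ae_hasDerivAt_integral
    rw [← ae_all_iff] at this
    filter_upwards [this] with t ht htI i
    rw [← uIcc_of_le hle] at htI
    exact ht i htI t₀ left_mem_uIcc
  let V : ℝ → ℝ := fun t => ∑ i, X t i * ∑ j, P t i j * X t j
  have hVeq : ∀ t, V t = X t ⬝ᵥ (P t *ᵥ X t) := fun t => rfl
  have hXcont : ∀ i, ContinuousOn (fun t => X t i) (Icc t₀ (t₀ + T)) := fun i => by
    rw [← uIcc_of_le hle]; exact (hXac i).continuousOn
  have hVcont : ContinuousOn V (Icc t₀ (t₀ + T)) := by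
    refine continuousOn_finsetSum _ fun i _ => (hXcont i).mul ?_
    exact continuousOn_finsetSum _ fun j _ => (hPcont i j).mul (hXcont j)
  have hWcont : ContinuousOn (fun t => ∫ τ in t₀..t, g τ) (Icc t₀ (t₀ + T)) := by
    rw [← uIcc_of_le hle]
    exact (hwint.absolutelyContinuousOnInterval_intervalIntegral left_mem_uIcc).continuousOn
  have hgI : ∀ a ∈ Icc t₀ (t₀ + T), ∀ b ∈ Icc t₀ (t₀ + T), IntervalIntegrable g volume a b := by
    intro a ha b hb
    refine hwint.mono_set ?_
    rw [uIcc_of_le hle]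
    exact uIcc_subset_Icc ha hb
  have hloc : ∀ a b, a < b → Icc a b ⊆ Icc t₀ (t₀ + T) \ (D : Set ℝ) →
      V b - (∫ τ in t₀..b, g τ) ≤ V a - (∫ τ in t₀..a, g τ) := by
    intro a b hab hs
    have hs' : Icc a b ⊆ Icc t₀ (t₀ + T) := fun t ht => (hs ht).1
    have haI := hs' (left_mem_Icc.2 hab.le)
    have hbI := hs' (right_mem_Icc.2 hab.le)
    have ht0 : t₀ ∈ Icc t₀ (t₀ + T) := left_mem_Icc.2 hle
    have hsub : uIcc a b ⊆ uIcc t₀ (t₀ + T) := by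
      rw [uIcc_of_le hle, uIcc_of_le hab.le]; exact hs'
    have hPac : ∀ i j, AbsolutelyContinuousOnInterval (fun t => P t i j) a b := fun i j =>
      ioaux_ac_C1 _ (fun t => P' t i j) a b hab.le ((hP'cont i j).mono hs)
        (fun t ht => (hPderiv t (hs ht) i j).mono hs)
    have hVac : AbsolutelyContinuousOnInterval V a b := by
      refine ioaux_ac_sum _ _ _ _ fun i _ => ((hXac i).mono hsub).fun_mul ?_
      exact ioaux_ac_sum _ _ _ _ fun j _ => (hPac i j).fun_mul ((hXac j).mono hsub)
    have hmono : ∫ τ in a..b, deriv V τ ≤ ∫ τ in a..b, g τ := by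
      refine intervalIntegral.integral_mono_ae_restrict hab.le hVac.intervalIntegrable_deriv
        (hgI a haI b hbI) ?_
      have hna : ∀ᵐ t : ℝ, t ≠ a := by simp [ae_iff, measure_singleton]
      have hnb : ∀ᵐ t : ℝ, t ≠ b := by simp [ae_iff, measure_singleton]
      filter_upwards [ae_restrict_mem measurableSet_Icc, ae_restrict_of_ae hna,
        ae_restrict_of_ae hnb, ae_restrict_of_ae hXder] with t htI hta htb hX
      have hX := hX (hs' htI)
      have hPd : ∀ i j, HasDerivAt (fun s => P s i j) (P' t i j) t := fun i j =>
        ((hPderiv t (hs htI) i j).mono hs).hasDerivAt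
          (Icc_mem_nhds (lt_of_le_of_ne htI.1 (Ne.symm hta)) (lt_of_le_of_ne htI.2 htb))
      have hVd : HasDerivAt V (∑ i, (f t i * (∑ j, P t i j * X t j)
          + X t i * ∑ j, (P' t i j * X t j + P t i j * f t j))) t := by
        refine HasDerivAt.fun_sum fun i _ => (hX i).mul ?_
        exact HasDerivAt.fun_sum fun j _ => (hPd i j).mul (hX j)
      have hpt := ioaux_pointwise (A t) (P t) (P' t) (G t) (R t) (hDLMI t (hs htI)) (x t) (w t)
      rw [hVd.deriv]
      refine le_of_eq_of_le ?_ hpt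
      rw [hxX t (hs' htI)]
      have hft : f t = A t *ᵥ X t + G t *ᵥ w t := by
        rw [← hxX t (hs' htI)]
      rw [← hft, Finset.sum_add_distrib]
      simp only [Finset.sum_add_distrib, dotProduct, Matrix.mulVec, Pi.add_apply]
    rw [hVac.integral_deriv_eq_sub] at hmono
    have := intervalIntegral.integral_add_adjacent_intervals (hgI t₀ ht0 a haI) (hgI a haI b hbI)
    linarith
  have hglue := ioaux_glue t₀ (t₀ + T) D (fun t => V t - ∫ τ in t₀..t, g τ)
    (hVcont.sub hWcont) hloc t₀ (left_mem_Icc.2 hle) t ht ht.1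
  have hV0 : V t₀ = 0 := by simp [V, X]
  have hWle : ∫ τ in t₀..t, g τ ≤ 1 := by
    have h1 := intervalIntegral.integral_add_adjacent_intervals
      (hgI t₀ (left_mem_Icc.2 hle) t ht) (hgI t ht _ (right_mem_Icc.2 hle))
    have h2 : 0 ≤ ∫ τ in t..(t₀ + T), g τ := by
      refine intervalIntegral.integral_nonneg ht.2 fun u hu => ?_
      simpa using (hRpd u ⟨ht.1.trans hu.1, hu.2⟩).posSemidef.dotProduct_mulVec_nonneg (w u)
    linarith
  have hV1 : x t ⬝ᵥ (P t *ᵥ x t) ≤ 1 := by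
    rw [hxX t ht, ← hVeq]
    simp only [intervalIntegral.integral_same, hV0] at hglue
    linarith
  have hL := (hLMI t ht).posSemidef.dotProduct_mulVec_nonneg (x t)
  have hE : x t ⬝ᵥ (((C t)ᵀ * Q t * C t) *ᵥ x t) = (C t *ᵥ x t) ⬝ᵥ (Q t *ᵥ (C t *ᵥ x t)) := by
    rw [← Matrix.mulVec_mulVec, ← Matrix.mulVec_mulVec, Matrix.dotProduct_mulVec,
      Matrix.vecMul_transpose]
  simp only [star_trivial, Matrix.sub_mulVec, dotProduct_sub, Matrix.smul_mulVec, dotProduct_smul,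
    smul_eq_mul, hE] at hL
  by_contra hcon
  push Not at hcon
  nlinarith
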